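/- arXiv:math/0405477 — 3 statements merged into one kernel-verified Lean document; each statement's English description precedes it below -/
import Mathlib

section
/- In R = U[[h]] (Jordanian deformation of sl(3)): [H₁,H₂] = 0, [H₁,T⁻¹H₃] = [H₂,T⁻¹H₃] = 0, [H₁,E₁] = 2E₁, [H₂,E₂] = 2E₂, [H₁,E₂] = -E₂, [H₂,E₁] = -E₁, [T⁻¹H₃,E₁] = E₁ and [T⁻¹H₃,E₂] = E₂ (all brackets are commutators [a,b]=ab-ba). -/
noncomputable section

open LieAlgebra.SpecialLinear

/-- The generalized binomial coefficient `α(α-1)⋯(α-n+1)/n!`. -/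
def qbinom (α : ℚ) (n : ℕ) : ℚ :=
  (∏ i ∈ Finset.range n, (α - (i : ℚ))) / (n.factorial : ℚ)

/-- `U(sl(3,ℂ))`, the universal enveloping algebra of `sl(3,ℂ)`. -/
abbrev Usl3 : Type := UniversalEnvelopingAlgebra ℂ (sl (Fin 3) ℂ)

namespace Usl3

attribute [local instance 100] LieRing.ofAssociativeRing

/-- The canonical embedding `sl(3,ℂ) → U(sl(3,ℂ))`. -/
def ι : sl (Fin 3) ℂ →ₗ⁅ℂ⁆ Usl3 := UniversalEnvelopingAlgebra.ι ℂ

/-- `h₁`, the image of the matrix `E₁₁ - E₂₂`. -/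
def h₁ : Usl3 := ι ⟨Matrix.single 0 0 1 - Matrix.single 1 1 1,
  show _ ∈ LinearMap.ker (Matrix.traceLinearMap (Fin 3) ℂ ℂ) by
    simp [LinearMap.mem_ker, Matrix.trace_single_eq_same]⟩

/-- `h₂`, the image of the matrix `E₂₂ - E₃₃`. -/
def h₂ : Usl3 := ι ⟨Matrix.single 1 1 1 - Matrix.single 2 2 1,
  show _ ∈ LinearMap.ker (Matrix.traceLinearMap (Fin 3) ℂ ℂ) by
    simp [LinearMap.mem_ker, Matrix.trace_single_eq_same]⟩

/-- `e₁`, the image of the matrix `E₁₂`. -/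
def e₁ : Usl3 := ι (single 0 1 (by decide) (1 : ℂ))

/-- `e₂`, the image of the matrix `E₂₃`. -/
def e₂ : Usl3 := ι (single 1 2 (by decide) (1 : ℂ))

/-- `f₁`, the image of the matrix `E₂₁`. -/
def f₁ : Usl3 := ι (single 1 0 (by decide) (1 : ℂ))

/-- `f₂`, the image of the matrix `E₃₂`. -/
def f₂ : Usl3 := ι (single 2 1 (by decide) (1 : ℂ))

/-- `e₃ := e₁e₂ - e₂e₁`. -/
def e₃ : Usl3 := e₁ * e₂ - e₂ * e₁

/-- `f₃ := f₂f₁ - f₁f₂`. -/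
def f₃ : Usl3 := f₂ * f₁ - f₁ * f₂

/-- `h₃ := h₁ + h₂`. -/
def h₃ : Usl3 := h₁ + h₂

/-- `S := Σ_{n≥0} binom(1/2,n) h^{2n} e₃^{2n}` in `R = U(sl(3,ℂ))[[h]]`. -/
def S : PowerSeries Usl3 :=
  PowerSeries.mk fun m =>
    if m % 2 = 0 then ((qbinom (1/2) (m / 2) : ℚ) : ℂ) • e₃ ^ m else 0

/-- `T := h·e₃ + S`. -/
def T : PowerSeries Usl3 := PowerSeries.X * PowerSeries.C e₃ + S

/-- `T⁻¹ := -h·e₃ + S`. -/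
def Tinv : PowerSeries Usl3 := -(PowerSeries.X * PowerSeries.C e₃) + S

/-- `Σ_{n≥0} binom(α,n)(T-1)ⁿ`, well defined since `T - 1` has zero constant term
(the degree-`m` coefficient only receives contributions from `n ≤ m`). -/
def Tpow (α : ℚ) : PowerSeries Usl3 :=
  PowerSeries.mk fun m =>
    PowerSeries.coeff m
      (∑ n ∈ Finset.range (m + 1), ((qbinom α n : ℚ) : ℂ) • (T - 1) ^ n)

/-- `T^{1/2} := Σ_{n≥0} binom(1/2,n)(T-1)ⁿ`. -/
def Thalf : PowerSeries Usl3 := Tpow (1/2)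

/-- `T^{-1/2} := Σ_{n≥0} binom(-1/2,n)(T-1)ⁿ`. -/
def Tneghalf : PowerSeries Usl3 := Tpow (-(1/2))

/-- `E₁ := T^{1/2}e₁`. -/
def E₁ : PowerSeries Usl3 := Thalf * PowerSeries.C e₁

/-- `E₂ := T^{1/2}e₂`. -/
def E₂ : PowerSeries Usl3 := Thalf * PowerSeries.C e₂

/-- `H₃ := S·h₃`. -/
def H₃ : PowerSeries Usl3 := S * PowerSeries.C h₃

/-- `F₃ := f₃ - (h²/4)e₃(h₃² - 1)`. -/
def F₃ : PowerSeries Usl3 :=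
  PowerSeries.C f₃ -
    (1/4 : ℂ) • (PowerSeries.X ^ 2 * PowerSeries.C (e₃ * (h₃ ^ 2 - 1)))

/-- `H₁ := h₁ - (h/2)e₃T⁻¹h₃`. -/
def H₁ : PowerSeries Usl3 :=
  PowerSeries.C h₁ -
    (1/2 : ℂ) • (PowerSeries.X * PowerSeries.C e₃ * Tinv * PowerSeries.C h₃)

/-- `H₂ := h₂ - (h/2)e₃T⁻¹h₃`. -/
def H₂ : PowerSeries Usl3 :=
  PowerSeries.C h₂ -
    (1/2 : ℂ) • (PowerSeries.X * PowerSeries.C e₃ * Tinv * PowerSeries.C h₃)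

/-- `F₁ := T^{-1/2}(f₁ + (h/2)e₂Th₃)`. -/
def F₁ : PowerSeries Usl3 :=
  Tneghalf * (PowerSeries.C f₁ +
    (1/2 : ℂ) • (PowerSeries.X * PowerSeries.C e₂ * T * PowerSeries.C h₃))

/-- `F₂ := T^{-1/2}(f₂ - (h/2)e₁Th₃)`. -/
def F₂ : PowerSeries Usl3 :=
  Tneghalf * (PowerSeries.C f₂ -
    (1/2 : ℂ) • (PowerSeries.X * PowerSeries.C e₁ * T * PowerSeries.C h₃))

end Usl3

open PowerSeries (X C coeff derivative)

/-! ### Series in `X * a` for an element `a` of a noncommutative algebra -/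

section EvalXMul

variable {A : Type*} [Ring A] [Algebra ℂ A]

/-- The algebra homomorphism `f(X) ↦ f(X * a)` from `ℂ⟦X⟧` to `A⟦X⟧`. -/
def evalXMul (a : A) : PowerSeries ℂ →ₐ[ℂ] PowerSeries A :=
  AlgHom.ofLinearMap
    { toFun f := PowerSeries.mk fun n => coeff n f • a ^ n
      map_add' f g := by ext n; simp [add_smul]
      map_smul' c f := by ext n; simp [mul_smul] }
    (by
      ext n
      by_cases hn : n = 0 <;> simp [PowerSeries.coeff_one, hn])
    (fun f g => by
      ext n
      simp only [LinearMap.coe_mk, AddHom.coe_mk, PowerSeries.coeff_mk, PowerSeries.coeff_mul,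
        Finset.sum_smul]
      refine Finset.sum_congr rfl fun p hp => ?_
      rw [← Finset.HasAntidiagonal.mem_antidiagonal.mp hp, pow_add, smul_mul_smul_comm])

lemma coeff_evalXMul (a : A) (f : PowerSeries ℂ) (n : ℕ) :
    coeff n (evalXMul a f) = coeff n f • a ^ n := by
  simp [evalXMul]

lemma evalXMul_X (a : A) : evalXMul a X = X * C a := by
  ext n
  rw [coeff_evalXMul, PowerSeries.coeff_X, PowerSeries.coeff_mul_C, PowerSeries.coeff_X]
  split_ifs with h <;> simp [h]

/-- The Euler derivation `X * d/dX`. -/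
def eulerDerivation : Derivation ℂ (PowerSeries ℂ) (PowerSeries ℂ) :=
  (X : PowerSeries ℂ) • derivative ℂ

lemma eulerDerivation_X : eulerDerivation X = X := by
  simp [eulerDerivation]

lemma coeff_eulerDerivation (f : PowerSeries ℂ) (n : ℕ) :
    coeff n (eulerDerivation f) = n * coeff n f := by
  rw [eulerDerivation, Derivation.smul_apply, smul_eq_mul]
  cases n with
  | zero => simp
  | succ n =>
    rw [PowerSeries.coeff_succ_X_mul, PowerSeries.coeff_derivative]
    push_cast
    ring

/-- An element acting on `a` by a scalar `c` acts on series in `X * a` by `c` times the Euler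
derivation. -/
lemma C_mul_evalXMul {a y : A} {c : ℂ} (h : y * a - a * y = c • a) (f : PowerSeries ℂ) :
    C y * evalXMul a f = evalXMul a f * C y + evalXMul a ((c • eulerDerivation) f) := by
  have hpow (n : ℕ) : y * a ^ n = a ^ n * y + (c * n) • a ^ n := by
    induction n with
    | zero => simp
    | succ n ih =>
      have hya : y * a = a * y + c • a := by rw [← h]; abel
      rw [pow_succ, ← mul_assoc, ih, add_mul, mul_assoc, hya, mul_add, mul_assoc, smul_mul_assoc,
        mul_smul_comm, add_assoc, ← add_smul]
      push_cast
      ring_nf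
  ext n
  rw [map_add, PowerSeries.coeff_C_mul, PowerSeries.coeff_mul_C, coeff_evalXMul, coeff_evalXMul,
    Derivation.smul_apply, map_smul, coeff_eulerDerivation, mul_smul_comm, hpow, smul_add,
    smul_mul_assoc, smul_smul, smul_eq_mul]
  ring_nf

end EvalXMul

/-- The commutator of two elements with left coefficients in a commutative subring that is
normalized by both. -/
lemma commutator_map_mul {A R : Type*} [CommRing A] [Ring R] (φ : A →+* R) {x y : R}
    {δ ε : A → A} (hx : ∀ f, x * φ f = φ f * x + φ (δ f))
    (hy : ∀ f, y * φ f = φ f * y + φ (ε f)) (a b : A) :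
    φ a * x * (φ b * y) - φ b * y * (φ a * x) =
      φ (a * δ b) * y - φ (b * ε a) * x + φ (a * b) * (x * y - y * x) := by
  have h₁ : φ a * x * (φ b * y) = φ a * (x * φ b) * y := by simp only [mul_assoc]
  have h₂ : φ b * y * (φ a * x) = φ b * (y * φ a) * x := by simp only [mul_assoc]
  have h₃ : φ b * φ a = φ a * φ b := by rw [← map_mul, mul_comm, map_mul]
  rw [h₁, h₂, hx, hy]
  simp only [map_mul, mul_add, add_mul, mul_sub, ← mul_assoc, h₃]
  abel

/-! ### The scalar series -/

lemma qbinom_eq_choose (α : ℚ) (n : ℕ) : qbinom α n = Ring.choose α n := by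
  rw [Ring.choose_eq_smul, qbinom, div_eq_inv_mul, smul_eq_mul]
  congr 1
  induction n with
  | zero => simp
  | succ n ih =>
    rw [Finset.prod_range_succ, ih, descPochhammer_succ_right, Polynomial.smeval_mul,
      Polynomial.smeval_sub, Polynomial.smeval_X, Polynomial.smeval_natCast]
    simp

lemma coeff_binomialSeries_eq_qbinom (α : ℚ) (n : ℕ) :
    coeff n (PowerSeries.binomialSeries ℂ α) = (qbinom α n : ℂ) := by
  rw [PowerSeries.binomialSeries_coeff, qbinom_eq_choose, Rat.smul_one_eq_cast]

lemma binomialSeries_half_sq : PowerSeries.binomialSeries ℂ (1 / 2 : ℚ) ^ 2 = 1 + X := by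
  rw [sq, ← PowerSeries.binomialSeries_add, add_halves]
  simpa using PowerSeries.binomialSeries_nat (R := ℚ) (A := ℂ) 1

/-- The scalar series `√(1 + X²)`. -/
def sqrtOneAddSq : PowerSeries ℂ :=
  (PowerSeries.binomialSeries ℂ (1 / 2 : ℚ)).subst (X ^ 2 : PowerSeries ℂ)

/-- The scalar series `X + √(1 + X²)`. -/
def expArsinh : PowerSeries ℂ := X + sqrtOneAddSq

/-- The scalar series `(X + √(1 + X²))^{1/2}`. -/
def sqrtExpArsinh : PowerSeries ℂ :=
  (PowerSeries.binomialSeries ℂ (1 / 2 : ℚ)).subst (expArsinh - 1)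

lemma sqrtOneAddSq_sq : sqrtOneAddSq ^ 2 = 1 + X ^ 2 := by
  have h : PowerSeries.HasSubst (X ^ 2 : PowerSeries ℂ) := .X_pow two_ne_zero
  rw [sqrtOneAddSq, ← PowerSeries.subst_pow h, binomialSeries_half_sq,
    ← PowerSeries.coe_substAlgHom h, map_add, map_one, PowerSeries.substAlgHom_X]

lemma coeff_sqrtOneAddSq (n : ℕ) :
    coeff n sqrtOneAddSq = if n % 2 = 0 then (qbinom (1 / 2) (n / 2) : ℂ) else 0 := by
  rw [sqrtOneAddSq, PowerSeries.coeff_subst_X_pow two_ne_zero, coeff_binomialSeries_eq_qbinom]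
  simp [Nat.dvd_iff_mod_eq_zero]

lemma constantCoeff_expArsinh_sub_one : PowerSeries.constantCoeff (expArsinh - 1) = 0 := by
  rw [expArsinh, ← PowerSeries.coeff_zero_eq_constantCoeff_apply, map_sub, map_add,
    coeff_sqrtOneAddSq]
  simp [qbinom]

lemma sqrtExpArsinh_sq : sqrtExpArsinh ^ 2 = expArsinh := by
  have h := PowerSeries.HasSubst.of_constantCoeff_zero' constantCoeff_expArsinh_sub_one
  rw [sqrtExpArsinh, ← PowerSeries.subst_pow h, binomialSeries_half_sq,
    ← PowerSeries.coe_substAlgHom h, map_add, map_one, PowerSeries.substAlgHom_X]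
  exact add_sub_cancel _ _

lemma coeff_sqrtExpArsinh (m : ℕ) :
    coeff m sqrtExpArsinh = coeff m (∑ n ∈ Finset.range (m + 1),
      (qbinom (1 / 2) n : ℂ) • (expArsinh - 1) ^ n) := by
  have h := PowerSeries.HasSubst.of_constantCoeff_zero' constantCoeff_expArsinh_sub_one
  rw [sqrtExpArsinh, PowerSeries.coeff_subst' h, map_sum,
    finsum_eq_sum_of_support_subset (s := Finset.range (m + 1))]
  · simp only [coeff_binomialSeries_eq_qbinom, map_smul]
  · intro n hn
    by_contra hlt
    rw [Finset.mem_coe, Finset.mem_range, not_lt] at hlt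
    refine hn ?_
    dsimp only
    rw [PowerSeries.X_pow_dvd_iff.mp (pow_dvd_pow_of_dvd
      (PowerSeries.X_dvd_iff.mpr constantCoeff_expArsinh_sub_one) n) m hlt, smul_zero]

lemma two_ne_zero_powerSeries : (2 : PowerSeries ℂ) ≠ 0 := by
  rw [← map_ofNat (C (R := ℂ)) 2, map_ne_zero_iff _ PowerSeries.C_injective]
  exact two_ne_zero

lemma sub_X_mul_expArsinh : (sqrtOneAddSq - X) * expArsinh = 1 := by
  rw [expArsinh]
  linear_combination sqrtOneAddSq_sq

lemma sqrtExpArsinh_ne_zero : sqrtExpArsinh ≠ 0 := fun h => by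
  have := sub_X_mul_expArsinh
  simp [← sqrtExpArsinh_sq, h] at this

lemma sqrtOneAddSq_mul_eulerDerivation :
    sqrtOneAddSq * eulerDerivation sqrtOneAddSq = X ^ 2 := by
  have h := congrArg eulerDerivation sqrtOneAddSq_sq
  simp only [sq, map_add, Derivation.leibniz, Derivation.map_one_eq_zero, smul_eq_mul,
    eulerDerivation_X] at h
  refine mul_left_cancel₀ two_ne_zero_powerSeries ?_
  linear_combination h

lemma two_mul_sqrtOneAddSq_mul_eulerDerivation :
    2 * sqrtOneAddSq * eulerDerivation sqrtExpArsinh = X * sqrtExpArsinh := by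
  have h := congrArg eulerDerivation sqrtExpArsinh_sq
  have hsq := sqrtExpArsinh_sq
  rw [expArsinh] at h hsq
  simp only [sq, map_add, Derivation.leibniz, smul_eq_mul, eulerDerivation_X] at h hsq
  refine mul_left_cancel₀ sqrtExpArsinh_ne_zero ?_
  linear_combination sqrtOneAddSq * h - X * hsq + sqrtOneAddSq_mul_eulerDerivation

/-- The scalar series of the coefficient of `h₃` in `T⁻¹H₃`. -/
def cartanCoeff : PowerSeries ℂ := (sqrtOneAddSq - X) * sqrtOneAddSq

/-- The scalar series of the coefficient of `-h₃` in `H₁` and `H₂`. -/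
def shiftCoeff : PowerSeries ℂ := (1 / 2 : ℂ) • (X * (sqrtOneAddSq - X))

lemma two_mul_shiftCoeff : 2 * shiftCoeff = X * (sqrtOneAddSq - X) := by
  rw [shiftCoeff, mul_smul_comm, two_mul, ← two_smul ℂ, smul_smul]
  norm_num

lemma cartanCoeff_eq : cartanCoeff = 1 - 2 * shiftCoeff := by
  rw [two_mul_shiftCoeff, cartanCoeff]
  linear_combination sqrtOneAddSq_sq

lemma eulerDerivation_cartanCoeff :
    eulerDerivation cartanCoeff = -2 * eulerDerivation shiftCoeff := by
  rw [cartanCoeff_eq, two_mul, map_sub, map_add, Derivation.map_one_eq_zero]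
  ring

lemma cartanCoeff_mul :
    cartanCoeff * (2 * eulerDerivation sqrtExpArsinh + sqrtExpArsinh) = sqrtExpArsinh := by
  have h := sub_X_mul_expArsinh
  rw [expArsinh] at h
  rw [cartanCoeff]
  linear_combination (sqrtOneAddSq - X) * two_mul_sqrtOneAddSq_mul_eulerDerivation +
    sqrtExpArsinh * h

lemma shiftCoeff_mul :
    shiftCoeff * (2 * eulerDerivation sqrtExpArsinh + sqrtExpArsinh) =
      eulerDerivation sqrtExpArsinh := by
  have h := cartanCoeff_mul
  rw [cartanCoeff_eq] at h
  refine mul_left_cancel₀ two_ne_zero_powerSeries ?_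
  linear_combination -h

namespace Usl3

attribute [local instance 100] LieRing.ofAssociativeRing

/-! ### Commutation relations in `U(sl(3,ℂ))` -/

lemma ι_commutator {x y z : sl (Fin 3) ℂ}
    (h : (x : Matrix (Fin 3) (Fin 3) ℂ) * y.1 - y.1 * x.1 = z.1) :
    ι x * ι y - ι y * ι x = ι z := by
  rw [← Ring.lie_def, ← LieHom.map_lie]
  exact congrArg ι (Subtype.ext h)

lemma e₃_eq : e₃ = ι (single 0 2 (by decide) (1 : ℂ)) :=
  ι_commutator (by simp)

lemma h₁_e₁ : h₁ * e₁ - e₁ * h₁ = 2 * e₁ := by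
  rw [two_mul, e₁, ← map_add]
  exact ι_commutator (by simp [sub_mul, mul_sub])

lemma h₁_e₂ : h₁ * e₂ - e₂ * h₁ = -e₂ := by
  rw [e₂, ← map_neg]
  exact ι_commutator (by simp [sub_mul, mul_sub])

lemma h₂_e₁ : h₂ * e₁ - e₁ * h₂ = -e₁ := by
  rw [e₁, ← map_neg]
  exact ι_commutator (by simp [sub_mul, mul_sub])

lemma h₂_e₂ : h₂ * e₂ - e₂ * h₂ = 2 * e₂ := by
  rw [two_mul, e₂, ← map_add]
  exact ι_commutator (by simp [sub_mul, mul_sub])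

lemma h₁_h₂ : h₁ * h₂ - h₂ * h₁ = 0 := by
  rw [← map_zero ι]
  exact ι_commutator (by simp [sub_mul, mul_sub])

lemma h₁_e₃ : h₁ * e₃ - e₃ * h₁ = (1 : ℂ) • e₃ := by
  rw [one_smul, e₃_eq]
  exact ι_commutator (by simp [sub_mul, mul_sub])

lemma h₂_e₃ : h₂ * e₃ - e₃ * h₂ = (1 : ℂ) • e₃ := by
  rw [one_smul, e₃_eq]
  exact ι_commutator (by simp [sub_mul, mul_sub])

lemma h₃_e₃ : h₃ * e₃ - e₃ * h₃ = (2 : ℂ) • e₃ := by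
  rw [h₃, add_mul, mul_add, add_sub_add_comm, h₁_e₃, h₂_e₃, ← add_smul, one_add_one_eq_two]

lemma e₁_e₃ : e₁ * e₃ - e₃ * e₁ = (0 : ℂ) • e₃ := by
  rw [zero_smul, ← map_zero ι, e₃_eq]
  exact ι_commutator (by simp)

lemma e₂_e₃ : e₂ * e₃ - e₃ * e₂ = (0 : ℂ) • e₃ := by
  rw [zero_smul, ← map_zero ι, e₃_eq]
  exact ι_commutator (by simp)

/-! ### The deformed generators as series in `h * e₃` -/

lemma S_eq : S = evalXMul e₃ sqrtOneAddSq := by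
  ext m
  rw [coeff_evalXMul, coeff_sqrtOneAddSq, S, PowerSeries.coeff_mk, ite_smul, zero_smul]

lemma T_eq : T = evalXMul e₃ expArsinh := by
  rw [T, S_eq, expArsinh, map_add, evalXMul_X]

lemma Tinv_eq : Tinv = evalXMul e₃ (sqrtOneAddSq - X) := by
  rw [Tinv, S_eq, map_sub, evalXMul_X, neg_add_eq_sub]

lemma Thalf_eq : Thalf = evalXMul e₃ sqrtExpArsinh := by
  ext m
  rw [Thalf, Tpow, PowerSeries.coeff_mk, coeff_evalXMul, coeff_sqrtExpArsinh, ← coeff_evalXMul]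
  simp only [map_sum, map_smul, map_pow, map_sub, map_one, T_eq]

lemma Tinv_mul_H₃_eq : Tinv * H₃ = evalXMul e₃ cartanCoeff * C h₃ := by
  rw [H₃, Tinv_eq, S_eq, ← mul_assoc, ← map_mul, cartanCoeff]

lemma H₁_eq : H₁ = C h₁ - evalXMul e₃ shiftCoeff * C h₃ := by
  rw [H₁, Tinv_eq, shiftCoeff, map_smul, map_mul, evalXMul_X, smul_mul_assoc]

lemma H₂_eq : H₂ = C h₂ - evalXMul e₃ shiftCoeff * C h₃ := by
  rw [H₂, Tinv_eq, shiftCoeff, map_smul, map_mul, evalXMul_X, smul_mul_assoc]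

/-- Commutators of elements `f(h e₃) x` with `x` acting on `e₃` by a scalar. -/
lemma commutator_evalXMul {x y : Usl3} {c d : ℂ} (hx : x * e₃ - e₃ * x = c • e₃)
    (hy : y * e₃ - e₃ * y = d • e₃) (a b : PowerSeries ℂ) :
    evalXMul e₃ a * C x * (evalXMul e₃ b * C y) - evalXMul e₃ b * C y * (evalXMul e₃ a * C x) =
      evalXMul e₃ (c • (a * eulerDerivation b)) * C y
        - evalXMul e₃ (d • (b * eulerDerivation a)) * C x
        + evalXMul e₃ (a * b) * C (x * y - y * x) := by
  have h := commutator_map_mul (evalXMul e₃ : PowerSeries ℂ →+* PowerSeries Usl3)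
    (C_mul_evalXMul hx) (C_mul_evalXMul hy) a b
  simpa only [RingHom.coe_coe, Derivation.smul_apply, mul_smul_comm, map_sub, map_mul] using h

lemma commutator_C_evalXMul {x y : Usl3} {c d : ℂ} (hx : x * e₃ - e₃ * x = c • e₃)
    (hy : y * e₃ - e₃ * y = d • e₃) (b : PowerSeries ℂ) :
    C x * (evalXMul e₃ b * C y) - evalXMul e₃ b * C y * C x =
      evalXMul e₃ (c • eulerDerivation b) * C y + evalXMul e₃ b * C (x * y - y * x) := by
  simpa using commutator_evalXMul hx hy 1 b

lemma commutator_cartan_sqrt {y : Usl3} (hy : y * e₃ - e₃ * y = (0 : ℂ) • e₃)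
    (h : h₃ * y - y * h₃ = y) :
    Tinv * H₃ * (Thalf * C y) - Thalf * C y * (Tinv * H₃) = Thalf * C y := by
  rw [Tinv_mul_H₃_eq, Thalf_eq, commutator_evalXMul h₃_e₃ hy, h, zero_smul, map_zero, zero_mul,
    sub_zero, ← add_mul, ← map_add]
  congr 2
  rw [ofNat_smul_eq_nsmul, nsmul_eq_mul, Nat.cast_ofNat]
  linear_combination cartanCoeff_mul

lemma commutator_shift_sqrt {x y : Usl3} (hx : x * e₃ - e₃ * x = (1 : ℂ) • e₃)
    (hy : y * e₃ - e₃ * y = (0 : ℂ) • e₃) (h : h₃ * y - y * h₃ = y) :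
    (C x - evalXMul e₃ shiftCoeff * C h₃) * (Thalf * C y)
      - Thalf * C y * (C x - evalXMul e₃ shiftCoeff * C h₃) = Thalf * C (x * y - y * x) := by
  rw [Thalf_eq, sub_mul, mul_sub, sub_sub_sub_comm, commutator_C_evalXMul hx hy,
    commutator_evalXMul h₃_e₃ hy, h, zero_smul, map_zero, zero_mul, sub_zero, ← add_mul, ← map_add,
    one_smul, add_sub_right_comm, ← sub_mul, ← map_sub, add_eq_right]
  convert zero_mul _
  convert map_zero (evalXMul e₃)
  rw [ofNat_smul_eq_nsmul, nsmul_eq_mul, Nat.cast_ofNat]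
  linear_combination -shiftCoeff_mul

lemma commutator_shift_cartan {x : Usl3} (hx : x * e₃ - e₃ * x = (1 : ℂ) • e₃)
    (h : x * h₃ - h₃ * x = 0) :
    (C x - evalXMul e₃ shiftCoeff * C h₃) * (Tinv * H₃)
      - Tinv * H₃ * (C x - evalXMul e₃ shiftCoeff * C h₃) = 0 := by
  rw [Tinv_mul_H₃_eq, sub_mul, mul_sub, sub_sub_sub_comm, commutator_C_evalXMul hx h₃_e₃,
    commutator_evalXMul h₃_e₃ h₃_e₃, h, sub_self, map_zero, mul_zero, mul_zero, add_zero, add_zero,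
    one_smul, ← sub_mul, ← map_sub, ← sub_mul, ← map_sub]
  convert zero_mul _
  convert map_zero (evalXMul e₃)
  simp only [ofNat_smul_eq_nsmul, nsmul_eq_mul, Nat.cast_ofNat]
  rw [eulerDerivation_cartanCoeff, cartanCoeff_eq]
  ring

lemma h₁_h₃ : h₁ * h₃ - h₃ * h₁ = 0 := by
  rw [h₃, mul_add, add_mul, add_sub_add_left_eq_sub, h₁_h₂]

lemma h₂_h₃ : h₂ * h₃ - h₃ * h₂ = 0 := by
  rw [h₃, mul_add, add_mul, add_sub_add_right_eq_sub, ← neg_sub, h₁_h₂, neg_zero]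

lemma h₃_e₁ : h₃ * e₁ - e₁ * h₃ = e₁ := by
  rw [h₃, add_mul, mul_add, add_sub_add_comm, h₁_e₁, h₂_e₁, two_mul, add_neg_cancel_right]

lemma h₃_e₂ : h₃ * e₂ - e₂ * h₃ = e₂ := by
  rw [h₃, add_mul, mul_add, add_sub_add_comm, h₁_e₂, h₂_e₂, two_mul, neg_add_cancel_left]

lemma H₁_H₂ : H₁ * H₂ - H₂ * H₁ = 0 := by
  have h := commutator_C_evalXMul h₁_e₃ h₃_e₃ shiftCoeff
  have h' := commutator_C_evalXMul h₂_e₃ h₃_e₃ shiftCoeff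
  have hC : C h₁ * C h₂ - C h₂ * C h₁ = 0 := by
    rw [← map_mul, ← map_mul, ← map_sub, h₁_h₂, map_zero]
  rw [h₁_h₃, map_zero, mul_zero, add_zero] at h
  rw [h₂_h₃, map_zero, mul_zero, add_zero, ← h] at h'
  rw [H₁_eq, H₂_eq]
  have expand (a b p : PowerSeries Usl3) : (a - p) * (b - p) - (b - p) * (a - p) =
      (a * b - b * a) + ((b * p - p * b) - (a * p - p * a)) := by noncomm_ring
  rw [expand, hC, h', sub_self, add_zero]

end Usl3

open Usl3 in
/-- In `R = U(sl(3,ℂ))[[h]]` (Jordanian deformation of `sl(3)`): `[H₁,H₂] = 0`,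
`[H₁,T⁻¹H₃] = [H₂,T⁻¹H₃] = 0`, `[H₁,E₁] = 2E₁`, `[H₂,E₂] = 2E₂`, `[H₁,E₂] = -E₂`,
`[H₂,E₁] = -E₁`, `[T⁻¹H₃,E₁] = E₁`, `[T⁻¹H₃,E₂] = E₂`. -/
theorem statement_5 :
    H₁ * H₂ - H₂ * H₁ = 0 ∧
    H₁ * (Tinv * H₃) - (Tinv * H₃) * H₁ = 0 ∧
    H₂ * (Tinv * H₃) - (Tinv * H₃) * H₂ = 0 ∧
    H₁ * E₁ - E₁ * H₁ = 2 * E₁ ∧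
    H₂ * E₂ - E₂ * H₂ = 2 * E₂ ∧
    H₁ * E₂ - E₂ * H₁ = -E₂ ∧
    H₂ * E₁ - E₁ * H₂ = -E₁ ∧
    (Tinv * H₃) * E₁ - E₁ * (Tinv * H₃) = E₁ ∧
    (Tinv * H₃) * E₂ - E₂ * (Tinv * H₃) = E₂ := by
  have two_mul_C (f : PowerSeries Usl3) (y : Usl3) : f * C (2 * y) = 2 * (f * C y) := by
    rw [two_mul, two_mul, map_add, mul_add]
  refine ⟨H₁_H₂, ?_, ?_, ?_, ?_, ?_, ?_,
    commutator_cartan_sqrt e₁_e₃ h₃_e₁, commutator_cartan_sqrt e₂_e₃ h₃_e₂⟩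
  · rw [H₁_eq, commutator_shift_cartan h₁_e₃ h₁_h₃]
  · rw [H₂_eq, commutator_shift_cartan h₂_e₃ h₂_h₃]
  · rw [H₁_eq, E₁, commutator_shift_sqrt h₁_e₃ e₁_e₃ h₃_e₁, h₁_e₁, two_mul_C]
  · rw [H₂_eq, E₂, commutator_shift_sqrt h₂_e₃ e₂_e₃ h₃_e₂, h₂_e₂, two_mul_C]
  · rw [H₁_eq, E₂, commutator_shift_sqrt h₁_e₃ e₂_e₃ h₃_e₂, h₁_e₂, map_neg, mul_neg]
  · rw [H₂_eq, E₁, commutator_shift_sqrt h₂_e₃ e₁_e₃ h₃_e₁, h₂_e₁, map_neg, mul_neg]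
end
end

section
/- In R = U[[h]] (Jordanian deformation of sl(N), N ≥ 3): the deformed raising generators satisfy [E_i,E_j] = 0 whenever |i-j| > 1, and the Serre relations E_i²E_j - 2E_iE_jE_i + E_jE_i² = 0 whenever |i-j| = 1 ([a,b]=ab-ba). -/
noncomputable section

open LieAlgebra.SpecialLinear

attribute [local instance 100] LieRing.ofAssociativeRing

/-- `U(sl(N,ℂ))`, the universal enveloping algebra of `sl(N,ℂ)`. -/
abbrev UslN (N : ℕ) : Type := UniversalEnvelopingAlgebra ℂ (sl (Fin N) ℂ)

namespace UslN

variable (N : ℕ)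

/-- The canonical embedding `sl(N,ℂ) → U(sl(N,ℂ))`. -/
def ι : sl (Fin N) ℂ →ₗ⁅ℂ⁆ UslN N := UniversalEnvelopingAlgebra.ι ℂ

/-- The Chevalley generator `e i` (0-based: the image of `E_{i,i+1}`, `0 ≤ i ≤ N-2`);
junk value `0` out of range. -/
def e (i : ℕ) : UslN N :=
  if h : i + 1 < N then
    ι N (single ⟨i, Nat.lt_of_succ_lt h⟩ ⟨i + 1, h⟩ (by simp [Fin.ext_iff]) (1 : ℂ))
  else 0

/-- The Chevalley generator `f i` (0-based: the image of `E_{i+1,i}`, `0 ≤ i ≤ N-2`);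
junk value `0` out of range. -/
def f (i : ℕ) : UslN N :=
  if h : i + 1 < N then
    ι N (single ⟨i + 1, h⟩ ⟨i, Nat.lt_of_succ_lt h⟩ (by simp [Fin.ext_iff]) (1 : ℂ))
  else 0

/-- The Chevalley generator `h i` (0-based: the image of `E_{ii} - E_{i+1,i+1}`,
`0 ≤ i ≤ N-2`); junk value `0` out of range. -/
def hgen (i : ℕ) : UslN N :=
  if h : i + 1 < N then
    ι N ⟨Matrix.single ⟨i, Nat.lt_of_succ_lt h⟩ ⟨i, Nat.lt_of_succ_lt h⟩ 1 -
          Matrix.single ⟨i + 1, h⟩ ⟨i + 1, h⟩ 1,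
      show _ ∈ LinearMap.ker (Matrix.traceLinearMap (Fin N) ℂ ℂ) by
        simp [LinearMap.mem_ker, Matrix.trace_single_eq_same]⟩
  else 0

/-- `h₁ + ⋯ + h_{N-1}`. -/
def hsum : UslN N := ∑ i ∈ Finset.range (N - 1), hgen N i

/-- The nested commutators `θ_j := [e_{N-2-j}, [⋯, [e_{N-3}, e_{N-2}]⋯]]` (0-based). -/
def thetaAux : ℕ → UslN N
  | 0 => e N (N - 2)
  | j + 1 =>
      e N (N - 2 - (j + 1)) * thetaAux j - thetaAux j * e N (N - 2 - (j + 1))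

/-- `θ := [e₁,[e₂,⋯,[e_{N-2},e_{N-1}]⋯]]` (1-based), the iterated commutator
corresponding to the highest root. -/
def θ : UslN N := thetaAux N (N - 2)

/-- `δ_i = 1` iff `i` is the first or the last simple-root index (0-based). -/
def δ (i : ℕ) : Prop := i = 0 ∨ i = N - 2

instance (i : ℕ) : Decidable (δ N i) := by unfold δ; infer_instance

/-- `S := Σ_{n≥0} binom(1/2,n) h^{2n} θ^{2n}` in `R = U(sl(N,ℂ))[[h]]`. -/
def S : PowerSeries (UslN N) :=
  PowerSeries.mk fun m =>
    if m % 2 = 0 then ((qbinom (1/2) (m / 2) : ℚ) : ℂ) • θ N ^ m else 0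

/-- `T := h·θ + S`. -/
def T : PowerSeries (UslN N) := PowerSeries.X * PowerSeries.C (θ N) + S N

/-- `T⁻¹ := -h·θ + S`. -/
def Tinv : PowerSeries (UslN N) := -(PowerSeries.X * PowerSeries.C (θ N)) + S N

/-- `T^{1/2} := Σ_{n≥0} binom(1/2,n)(T-1)ⁿ`, well defined since `T - 1` has zero
constant term. -/
def Thalf : PowerSeries (UslN N) :=
  PowerSeries.mk fun m =>
    PowerSeries.coeff m
      (∑ n ∈ Finset.range (m + 1), ((qbinom (1/2) n : ℚ) : ℂ) • (T N - 1) ^ n)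

/-- The `h`-deformed Cartan generators
`H_i := h_i - δ_i·(h/2)·θT⁻¹(h₁+⋯+h_{N-1})` (0-based index). -/
def H (i : ℕ) : PowerSeries (UslN N) :=
  PowerSeries.C (hgen N i) -
    (if δ N i then
      (1/2 : ℂ) • (PowerSeries.X * PowerSeries.C (θ N) * Tinv N *
        PowerSeries.C (hsum N))
    else 0)

/-- The `h`-deformed raising generators `E_i := T^{δ_i/2}·e_i` (0-based index). -/
def E (i : ℕ) : PowerSeries (UslN N) :=
  if δ N i then Thalf N * PowerSeries.C (e N i) else PowerSeries.C (e N i)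

/-- The Cartan matrix of `sl(N)` (0-based indices). -/
def cartan (i j : ℕ) : ℤ :=
  if i = j then 2 else if i + 1 = j ∨ j + 1 = i then -1 else 0

end UslN

namespace UslN

/-- The bracket of two elementary matrices whose indices are not composable vanishes in
`U(sl(N,ℂ))`. -/
theorem commute_ι_single {N : ℕ} {a b c d : Fin N} (hab : a ≠ b) (hcd : c ≠ d)
    (hbc : b ≠ c) (hda : d ≠ a) :
    Commute (ι N (single a b hab (1 : ℂ))) (ι N (single c d hcd (1 : ℂ))) := by
  have h : ⁅single a b hab (1 : ℂ), single c d hcd (1 : ℂ)⁆ = 0 := by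
    apply Subtype.ext
    rw [LieSubalgebra.coe_bracket, Ring.lie_def]
    simp [val_single, hbc, hda]
  have hmap := LieHom.map_lie (ι N) (single a b hab (1 : ℂ)) (single c d hcd (1 : ℂ))
  rw [h, map_zero, Ring.lie_def] at hmap
  exact sub_eq_zero.mp hmap.symm

/-- `[E_{ab}, E_{bc}] = E_{ac}` in `U(sl(N,ℂ))` for distinct `a`, `b`, `c`. -/
theorem ι_single_mul_sub {N : ℕ} {a b c : Fin N} (hab : a ≠ b) (hbc : b ≠ c) (hac : a ≠ c) :
    ι N (single a b hab (1 : ℂ)) * ι N (single b c hbc (1 : ℂ)) -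
      ι N (single b c hbc (1 : ℂ)) * ι N (single a b hab (1 : ℂ)) =
        ι N (single a c hac (1 : ℂ)) := by
  have h : ⁅single a b hab (1 : ℂ), single b c hbc (1 : ℂ)⁆ = single a c hac (1 : ℂ) := by
    apply Subtype.ext
    rw [LieSubalgebra.coe_bracket, Ring.lie_def]
    simp [val_single, hac.symm]
  have hmap := LieHom.map_lie (ι N) (single a b hab (1 : ℂ)) (single b c hbc (1 : ℂ))
  rw [h, Ring.lie_def] at hmap
  exact hmap.symm

theorem e_eq {N i : ℕ} (h : i + 1 < N) :
    e N i = ι N (single ⟨i, Nat.lt_of_succ_lt h⟩ ⟨i + 1, h⟩ (by simp [Fin.ext_iff]) (1 : ℂ)) :=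
  dif_pos h

theorem thetaAux_eq {N : ℕ} (hN : 2 ≤ N) (j : ℕ) (hj : j ≤ N - 2) :
    thetaAux N j = ι N (single ⟨N - 2 - j, by omega⟩ ⟨N - 1, by omega⟩
      (by simp only [ne_eq, Fin.ext_iff]; omega) (1 : ℂ)) := by
  induction j with
  | zero =>
    rw [thetaAux, e_eq (by omega)]
    congr 3
    simp only [Fin.ext_iff]
    omega
  | succ j ih =>
    rw [thetaAux, ih (by omega), e_eq (by omega)]
    have hidx : (⟨N - 2 - j, by omega⟩ : Fin N) = ⟨N - 2 - (j + 1) + 1, by omega⟩ := by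
      simp only [Fin.ext_iff]
      omega
    simp only [hidx]
    exact ι_single_mul_sub _ _ _

theorem commute_e_θ {N : ℕ} (hN : 3 ≤ N) (i : ℕ) : Commute (e N i) (θ N) := by
  by_cases h : i + 1 < N
  · rw [e_eq h, θ, thetaAux_eq (by omega) _ le_rfl]
    apply commute_ι_single <;> simp only [ne_eq, Fin.ext_iff] <;> omega
  · rw [e, dif_neg h]
    exact Commute.zero_left _

theorem commute_e_e {N i j : ℕ} (hi : i + 1 < N) (hj : j + 1 < N) (h1 : i + 1 ≠ j)
    (h2 : j + 1 ≠ i) : Commute (e N i) (e N j) := by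
  rw [e_eq hi, e_eq hj]
  apply commute_ι_single <;> simpa only [ne_eq, Fin.ext_iff]

theorem commute_e_bracket {N i j : ℕ} (hi : i + 1 < N) (hj : j + 1 < N)
    (h : i + 1 = j ∨ j + 1 = i) : Commute (e N i) (e N i * e N j - e N j * e N i) := by
  rw [e_eq hi, e_eq hj]
  rcases h with rfl | rfl
  · rw [ι_single_mul_sub _ _ (by simp only [ne_eq, Fin.ext_iff]; omega)]
    apply commute_ι_single <;> simp only [ne_eq, Fin.ext_iff] <;> omega
  · rw [← neg_sub, ι_single_mul_sub _ _ (by simp only [ne_eq, Fin.ext_iff]; omega)]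
    apply Commute.neg_right
    apply commute_ι_single <;> simp only [ne_eq, Fin.ext_iff] <;> omega

theorem commute_C_iff {R : Type*} [Semiring R] {a : R} {p : PowerSeries R} :
    Commute (PowerSeries.C a) p ↔ ∀ m, Commute a (PowerSeries.coeff m p) := by
  simp only [Commute, SemiconjBy, PowerSeries.ext_iff, PowerSeries.coeff_C_mul,
    PowerSeries.coeff_mul_C]

theorem commute_C_T {N : ℕ} {a : UslN N} (ha : Commute a (θ N)) :
    Commute (PowerSeries.C a) (T N) := by
  refine Commute.add_right ((PowerSeries.commute_X _).mul_right ?_) ?_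
  · exact ha.map PowerSeries.C
  · refine commute_C_iff.mpr fun m => ?_
    rw [S, PowerSeries.coeff_mk]
    split_ifs
    · exact (ha.pow_right m).smul_right _
    · exact Commute.zero_right _

theorem commute_C_Thalf {N : ℕ} {a : UslN N} (ha : Commute a (θ N)) :
    Commute (PowerSeries.C a) (Thalf N) := by
  refine commute_C_iff.mpr fun m => ?_
  rw [Thalf, PowerSeries.coeff_mk]
  refine commute_C_iff.mp (Commute.sum_right _ _ _ fun n _ => ?_) m
  exact (((commute_C_T ha).sub_right (Commute.one_right _)).pow_right n).smul_right _

/-- The factor `T^{δ_i/2}` of `E_i`. -/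
def twist (N i : ℕ) : PowerSeries (UslN N) := if δ N i then Thalf N else 1

theorem E_eq (N i : ℕ) : E N i = twist N i * PowerSeries.C (e N i) := by
  unfold E twist
  split_ifs <;> simp

theorem commute_twist_twist (N i j : ℕ) : Commute (twist N i) (twist N j) := by
  unfold twist
  split_ifs <;> simp

theorem commute_twist_C_e {N : ℕ} (hN : 3 ≤ N) (i j : ℕ) :
    Commute (twist N i) (PowerSeries.C (e N j)) := by
  unfold twist
  split_ifs
  · exact (commute_C_Thalf (commute_e_θ hN j)).symm
  · exact Commute.one_left _

/-- Rescaling by commuting factors rescales the commutator. -/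
theorem bracket_twisted {A : Type*} [Ring A] {s r x y : A} (hsr : Commute s r)
    (hry : Commute r x) (hsy : Commute s y) :
    s * x * (r * y) - r * y * (s * x) = s * r * (x * y - y * x) := by
  rw [hry.symm.mul_mul_mul_comm, hsy.symm.mul_mul_mul_comm, hsr.eq, mul_sub]

theorem serre_eq_bracket {A : Type*} [Ring A] (x y : A) :
    x ^ 2 * y - 2 * (x * y * x) + y * x ^ 2 =
      x * (x * y - y * x) - (x * y - y * x) * x := by
  noncomm_ring

end UslN

open UslN in
/-- In `R = U(sl(N,ℂ))[[h]]` (Jordanian deformation of `sl(N)`, `N ≥ 3`): for all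
simple-root indices `i, j` (0-based, so `i, j < N - 1`), `[E_i,E_j] = 0` whenever
`|i-j| > 1`, and the Serre relations `E_i²E_j - 2E_iE_jE_i + E_jE_i² = 0` whenever
`|i-j| = 1`. -/
theorem statement_12 (N : ℕ) (hN : 3 ≤ N) (i j : ℕ) (hi : i < N - 1) (hj : j < N - 1) :
    ((1 < (i : ℤ) - j ∨ 1 < (j : ℤ) - i) → E N i * E N j - E N j * E N i = 0) ∧
    (((i : ℤ) - j = 1 ∨ (j : ℤ) - i = 1) →
      E N i ^ 2 * E N j - 2 * (E N i * E N j * E N i) + E N j * E N i ^ 2 = 0) := by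
  have hbr : E N i * E N j - E N j * E N i = twist N i * twist N j *
      PowerSeries.C (e N i * e N j - e N j * e N i) := by
    rw [E_eq, E_eq, bracket_twisted (commute_twist_twist N i j) (commute_twist_C_e hN j i)
      (commute_twist_C_e hN i j), map_sub, map_mul, map_mul]
  refine ⟨fun h => ?_, fun h => ?_⟩
  · rw [hbr, sub_eq_zero.mpr (commute_e_e (by omega) (by omega) (by omega) (by omega)).eq,
      map_zero, mul_zero]
  · rw [serre_eq_bracket, hbr, sub_eq_zero, E_eq]
    have hx := commute_twist_C_e hN
    refine Commute.mul_left (Commute.mul_right ?_ ?_) (Commute.mul_right ?_ ?_)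
    · exact (commute_twist_twist N i i).mul_right (commute_twist_twist N i j)
    · simp only [map_sub, map_mul]
      exact ((hx i i).mul_right (hx i j)).sub_right ((hx i j).mul_right (hx i i))
    · exact ((hx i i).mul_left (hx j i)).symm
    · exact (commute_e_bracket (by omega) (by omega) (by omega)).map PowerSeries.C
end
end

section
/- Fix h ∈ ℂ. As q → 1 (q ∈ ℝ, q > 0, q ≠ 1), the 4×4 matrices G(q)⁻¹·R_q·G(q) converge to the matrix [[1, h, -h, h²], [0, 1, 0, h], [0, 0, 1, -h], [0, 0, 0, 1]]. (This is the contraction producing the Jordanian R_h-matrix of U_h(sl(2)) in the spin-1/2 ⊗ spin-1/2 representation.) -/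
noncomputable section

open Matrix
open scoped Kronecker Topology ComplexOrder

/-- The R-matrix of `U_q(sl(2))` in the spin-1/2 ⊗ spin-1/2 representation (`q > 0`
real): nonzero entries `(R_q)₁₁ = (R_q)₄₄ = q^{1/2}`, `(R_q)₂₂ = (R_q)₃₃ = q^{-1/2}`,
`(R_q)₂₃ = q^{1/2} - q^{-3/2}` (1-based indexing). -/
def Rq (q : ℝ) : Matrix (Fin 4) (Fin 4) ℂ :=
  Matrix.of fun i j =>
    if i = j then
      (if i = 0 ∨ i = 3 then ((q ^ ((1 : ℝ)/2) : ℝ) : ℂ)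
       else ((q ^ (-(1 : ℝ)/2) : ℝ) : ℂ))
    else if (i, j) = (1, 2) then
      ((q ^ ((1 : ℝ)/2) : ℝ) : ℂ) - ((q ^ (-(3 : ℝ)/2) : ℝ) : ℂ)
    else 0

/-- `g(q) := I₂ + (h/(q-1))·E₁₂`. -/
def gq (h : ℂ) (q : ℝ) : Matrix (Fin 2) (Fin 2) ℂ :=
  1 + (h / ((q : ℂ) - 1)) • Matrix.single 0 1 1

/-- `G(q) := g(q) ⊗ g(q)`, the Kronecker product, as a 4×4 matrix (row-major
reindexing of `Fin 2 × Fin 2`). -/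
def Gq (h : ℂ) (q : ℝ) : Matrix (Fin 4) (Fin 4) ℂ :=
  Matrix.reindex finProdFinEquiv finProdFinEquiv (gq h q ⊗ₖ gq h q)

theorem Gq_eq (h : ℂ) (q : ℝ) {t : ℂ} (ht : t = h / ((q : ℂ) - 1)) :
    Gq h q = !![1, t, t, t ^ 2; 0, 1, 0, t; 0, 0, 1, t; 0, 0, 0, 1] := by
  subst ht
  ext i j
  fin_cases i <;> fin_cases j <;>
    simp [Gq, gq, finProdFinEquiv, Fin.divNat, Fin.modNat, Matrix.single, sq]

theorem Gq_inv (h : ℂ) (q : ℝ) {t : ℂ} (ht : t = h / ((q : ℂ) - 1)) :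
    (Gq h q)⁻¹ = !![1, -t, -t, t ^ 2; 0, 1, 0, -t; 0, 0, 1, -t; 0, 0, 0, 1] := by
  apply Matrix.inv_eq_left_inv
  rw [Gq_eq h q ht]
  ext i j
  fin_cases i <;> fin_cases j <;> simp [Matrix.mul_apply, Fin.sum_univ_four] <;> ring

/-- All entries of `R_q` are polynomial in `q` up to the common factor `q^{-3/2}`. -/
theorem Rq_eq {q : ℝ} (hq : 0 < q) {s : ℂ} (hs : s = ((q ^ (-(3 : ℝ) / 2) : ℝ) : ℂ)) :
    Rq q = !![s * q ^ 2, 0, 0, 0; 0, s * q, s * q ^ 2 - s, 0; 0, 0, s * q, 0;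
      0, 0, 0, s * q ^ 2] := by
  have h1 : ((q ^ ((1 : ℝ) / 2) : ℝ) : ℂ) = s * q ^ 2 := by
    have : q ^ ((1 : ℝ) / 2) = q ^ (-(3 : ℝ) / 2) * q ^ 2 := by
      rw [← Real.rpow_natCast, ← Real.rpow_add hq]
      norm_num
    rw [hs, this]
    push_cast
    rfl
  have h2 : ((q ^ (-(1 : ℝ) / 2) : ℝ) : ℂ) = s * q := by
    have : q ^ (-(1 : ℝ) / 2) = q ^ (-(3 : ℝ) / 2) * q := by
      rw [← Real.rpow_add_one hq.ne']
      norm_num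
    rw [hs, this]
    push_cast
    rfl
  unfold Rq
  rw [h1, h2, ← hs]
  ext i j
  fin_cases i <;> fin_cases j <;> simp

/-- The poles at `q = 1` cancel in the conjugated R-matrix. -/
theorem Gq_inv_mul_Rq_mul_Gq (h : ℂ) {q : ℝ} (hq : 0 < q) (hq1 : q ≠ 1) {s : ℂ}
    (hs : s = ((q ^ (-(3 : ℝ) / 2) : ℝ) : ℂ)) :
    (Gq h q)⁻¹ * Rq q * Gq h q =
      !![s * q ^ 2, h * (s * q), -(h * s), h ^ 2 * s; 0, s * q, s * q ^ 2 - s, h * s;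
        0, 0, s * q, -(h * (s * q)); 0, 0, 0, s * q ^ 2] := by
  obtain ⟨t, ht⟩ : ∃ t, t = h / ((q : ℂ) - 1) := ⟨_, rfl⟩
  have hne : (q : ℂ) - 1 ≠ 0 := sub_ne_zero.mpr (by exact_mod_cast hq1)
  have hh : h = t * (q - 1) := by rw [ht, div_mul_cancel₀ _ hne]
  rw [Gq_inv h q ht, Rq_eq hq hs, Gq_eq h q ht, hh]
  ext i j
  fin_cases i <;> fin_cases j <;> simp [Matrix.mul_apply, Fin.sum_univ_four] <;> ring

/-- Contraction producing the Jordanian `R_h`-matrix of `U_h(sl(2))` in the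
spin-1/2 ⊗ spin-1/2 representation: as `q → 1` (within `(0,∞)`, `q ≠ 1`),
`G(q)⁻¹·R_q·G(q) → [[1,h,-h,h²],[0,1,0,h],[0,0,1,-h],[0,0,0,1]]`. -/
theorem statement_18 (h : ℂ) :
    Filter.Tendsto (fun q : ℝ => (Gq h q)⁻¹ * Rq q * Gq h q)
      (𝓝[Set.Ioi (0 : ℝ) \ {1}] (1 : ℝ))
      (𝓝 (!![1, h, -h, h ^ 2; 0, 1, 0, h; 0, 0, 1, -h; 0, 0, 0, 1])) := by
  have hs : Filter.Tendsto (fun q : ℝ => ((q ^ (-(3 : ℝ) / 2) : ℝ) : ℂ))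
      (𝓝[Set.Ioi (0 : ℝ) \ {1}] (1 : ℝ)) (𝓝 1) := by
    have hc : ContinuousAt (fun q : ℝ => ((q ^ (-(3 : ℝ) / 2) : ℝ) : ℂ)) 1 :=
      Complex.continuous_ofReal.continuousAt.comp
        (Real.continuousAt_rpow_const 1 _ (Or.inl one_ne_zero))
    simpa using hc.tendsto.mono_left nhdsWithin_le_nhds
  have hq : Filter.Tendsto (fun q : ℝ => (q : ℂ))
      (𝓝[Set.Ioi (0 : ℝ) \ {1}] (1 : ℝ)) (𝓝 1) := by
    simpa using (Complex.continuous_ofReal.tendsto 1).mono_left nhdsWithin_le_nhds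
  have hF : Continuous fun p : ℂ × ℂ =>
      !![p.1 * p.2 ^ 2, h * (p.1 * p.2), -(h * p.1), h ^ 2 * p.1;
        0, p.1 * p.2, p.1 * p.2 ^ 2 - p.1, h * p.1;
        0, 0, p.1 * p.2, -(h * (p.1 * p.2)); 0, 0, 0, p.1 * p.2 ^ 2] := by
    refine continuous_matrix fun i j => ?_
    fin_cases i <;> fin_cases j <;> simp <;> fun_prop
  have hlim := (hF.tendsto (1, 1)).comp (hs.prodMk_nhds hq)
  simp only [one_pow, mul_one, sub_self] at hlim
  refine hlim.congr' ?_
  filter_upwards [self_mem_nhdsWithin] with q hq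
  exact (Gq_inv_mul_Rq_mul_Gq h hq.1 hq.2 rfl).symm
end
end
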